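/- There is an absolute constant C such that for every weight ω on ℝ with [ω]_{A₂} < ∞ and every J ∈ 𝒟: ∑_{I∈𝒟, I⊆J} |⟨ω^{-1}, h_I⟩ ⟨ω, h_{I₋}⟩| / ⟨ω⟩_I ≤ C [ω]_{A₂} ω^{-1}(J). -/

import Mathlib

open MeasureTheory ENNReal NNReal

noncomputable section

/-- The dyadic interval `[2^n k, 2^n (k+1))`, encoded by the pair `p = (n, k)`. -/
def dyad (p : ℤ × ℤ) : Set ℝ := Set.Ico ((2:ℝ) ^ p.1 * p.2) ((2:ℝ) ^ p.1 * (p.2 + 1))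

/-- The length `2^n` of the dyadic interval encoded by `p = (n, k)`. -/
def len (p : ℤ × ℤ) : ℝ := (2:ℝ) ^ p.1

/-- The left half `I₋` of the dyadic interval. -/
def lhalf (p : ℤ × ℤ) : ℤ × ℤ := (p.1 - 1, 2 * p.2)

/-- The right half `I₊` of the dyadic interval. -/
def rhalf (p : ℤ × ℤ) : ℤ × ℤ := (p.1 - 1, 2 * p.2 + 1)

/-- The average `⟨f⟩_I = |I|⁻¹ ∫_I f` over the dyadic interval `p`. -/
def avg (f : ℝ → ℝ) (p : ℤ × ℤ) : ℝ := (len p)⁻¹ * ∫ x in dyad p, f x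

/-- The Haar function `h_I = |I|^{-1/2} (1_{I₋} - 1_{I₊})`. -/
def haar (p : ℤ × ℤ) : ℝ → ℝ := fun x =>
  (Real.sqrt (len p))⁻¹ *
    ((dyad (lhalf p)).indicator (fun _ => (1:ℝ)) x -
      (dyad (rhalf p)).indicator (fun _ => (1:ℝ)) x)

/-- The Haar coefficient `⟨f, h_I⟩ = ∫ f h_I`. -/
def haarCoeff (f : ℝ → ℝ) (p : ℤ × ℤ) : ℝ := ∫ x, f x * haar p x

/-- The A₂ characteristic `[ω]_{A₂} = sup_I ⟨ω⟩_I ⟨ω⁻¹⟩_I`, valued in `ℝ≥0∞`. -/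
def A2 (ω : ℝ → ℝ) : ℝ≥0∞ :=
  ⨆ p : ℤ × ℤ, ENNReal.ofReal (avg ω p * avg (fun x => (ω x)⁻¹) p)

/-- `ω` is a weight: measurable, positive, with `ω` and `ω⁻¹` locally integrable. -/
def IsWeight (ω : ℝ → ℝ) : Prop :=
  Measurable ω ∧ (∀ x, 0 < ω x) ∧
    LocallyIntegrable ω volume ∧ LocallyIntegrable (fun x => (ω x)⁻¹) volume

/-- The measure `ω dx`. -/
def wMeasure (ω : ℝ → ℝ) : Measure ℝ := volume.withDensity fun x => ENNReal.ofReal (ω x)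

/-- `ω^{1/2}`. -/
def sqrtw (ω : ℝ → ℝ) : ℝ → ℝ := fun x => Real.sqrt (ω x)

/-- `ω^{-1/2}`. -/
def invSqrtw (ω : ℝ → ℝ) : ℝ → ℝ := fun x => (Real.sqrt (ω x))⁻¹

lemma one_div_mul_midpoint_le {a₁ a₂ b₁ b₂ : ℝ} (ha₁ : 0 < a₁) (ha₂ : 0 < a₂) (hb₁ : 0 < b₁)
    (hb₂ : 0 < b₂) :
    1 / ((a₁ + a₂) / 2 * ((b₁ + b₂) / 2)) ≤ (1 / (a₁ * b₁) + 1 / (a₂ * b₂)) / 2 := by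
  have hx : 0 < a₁ * b₁ := by positivity
  have hy : 0 < a₂ * b₂ := by positivity
  rw [div_add_div _ _ hx.ne' hy.ne', div_div, div_le_div_iff₀ (by positivity) (by positivity)]
  nlinarith [sq_nonneg (a₁ * b₁ - a₂ * b₂), mul_pos ha₁ hb₂, mul_pos ha₂ hb₁,
    mul_nonneg hx.le (sq_nonneg (a₁ * b₂ - a₂ * b₁)),
    mul_nonneg hy.le (sq_nonneg (a₁ * b₂ - a₂ * b₁)),
    mul_nonneg (mul_pos ha₁ hb₂).le (sq_nonneg (a₁ * b₁ - a₂ * b₂)),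
    mul_nonneg (mul_pos ha₂ hb₁).le (sq_nonneg (a₁ * b₁ - a₂ * b₂))]

lemma sqrt_one_add_add_sqrt_one_sub_le {a : ℝ} (h₁ : -1 ≤ a) (h₂ : a ≤ 1) :
    √(1 + a) + √(1 - a) ≤ 2 - a ^ 2 / 4 := by
  have hs := Real.sq_sqrt (show 0 ≤ 1 + a by linarith)
  have ht := Real.sq_sqrt (show 0 ≤ 1 - a by linarith)
  have hst : √(1 + a) * √(1 - a) ≤ 1 - a ^ 2 / 2 := by
    rw [← Real.sqrt_mul (by linarith)]
    refine Real.sqrt_le_iff.2 ⟨by nlinarith, by nlinarith [sq_nonneg (a ^ 2)]⟩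
  refine abs_le_of_sq_le_sq' ?_ (by nlinarith) |>.2
  nlinarith [sq_nonneg (a ^ 2)]

lemma sqrt_sqrt_mul_le {x y : ℝ} (hx : 0 ≤ x) : √√(x * y) ≤ (√x + √y) / 2 := by
  rw [Real.sqrt_mul hx, Real.sqrt_mul (Real.sqrt_nonneg x)]
  nlinarith [sq_nonneg (√√x - √√y), Real.sq_sqrt (Real.sqrt_nonneg x),
    Real.sq_sqrt (Real.sqrt_nonneg y)]

/-- The auxiliary function `(uv/Q)^{1/4}`, which is strictly concave on the quadrant. -/
def quarticRoot (Q u v : ℝ) : ℝ := √√(u * v / Q)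

/-- The Bellman function `Q (v - 1 / (u (1 + (uv/Q)^{1/4})))`. -/
def bellman (Q u v : ℝ) : ℝ := Q * (v - 1 / (u * (1 + quarticRoot Q u v)))

lemma quarticRoot_nonneg (Q u v : ℝ) : 0 ≤ quarticRoot Q u v := Real.sqrt_nonneg _

lemma quarticRoot_le_one {Q u v : ℝ} (hQ : 0 < Q) (h : u * v ≤ Q) : quarticRoot Q u v ≤ 1 := by
  rw [quarticRoot, Real.sqrt_le_one, Real.sqrt_le_one]
  exact (div_le_one hQ).2 h

lemma mul_le_mul_quarticRoot {Q u v : ℝ} (hQ : 0 < Q) (hu : 0 < u) (hv : 0 < v) (h : u * v ≤ Q) :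
    u * v ≤ Q * quarticRoot Q u v := by
  have ht : u * v / Q = quarticRoot Q u v ^ 4 := by
    rw [quarticRoot, show 4 = 2 * 2 by rfl, pow_mul, Real.sq_sqrt (Real.sqrt_nonneg _),
      Real.sq_sqrt (by positivity)]
  rw [div_eq_iff hQ.ne'] at ht
  rw [ht, mul_comm]
  gcongr
  exact pow_le_of_le_one (quarticRoot_nonneg ..) (quarticRoot_le_one hQ h) (by norm_num)

lemma quarticRoot_scale {Q u v a b : ℝ} (hQ : 0 < Q) (hu : 0 < u) (hv : 0 < v) :
    quarticRoot Q (u * (1 + a)) (v * (1 + b)) = quarticRoot Q u v * √√((1 + a) * (1 + b)) := by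
  rw [quarticRoot, quarticRoot, ← Real.sqrt_mul (Real.sqrt_nonneg _),
    ← Real.sqrt_mul (by positivity)]
  congr 2
  ring

lemma quarticRoot_strict_concave {Q u v a b : ℝ} (hQ : 0 < Q) (hu : 0 < u) (hv : 0 < v)
    (ha : |a| ≤ 1) (hb : |b| ≤ 1) :
    (quarticRoot Q (u * (1 + a)) (v * (1 + b)) + quarticRoot Q (u * (1 - a)) (v * (1 - b))) / 2
      ≤ quarticRoot Q u v - quarticRoot Q u v * (a ^ 2 + b ^ 2) / 16 := by
  rw [abs_le] at ha hb
  simp only [sub_eq_add_neg, quarticRoot_scale hQ hu hv]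
  have h₁ := sqrt_sqrt_mul_le (y := 1 + b) (show 0 ≤ 1 + a by linarith)
  have h₂ := sqrt_sqrt_mul_le (y := 1 - b) (show 0 ≤ 1 - a by linarith)
  have h₃ := sqrt_one_add_add_sqrt_one_sub_le ha.1 ha.2
  have h₄ := sqrt_one_add_add_sqrt_one_sub_le hb.1 hb.2
  have h₅ := quarticRoot_nonneg Q u v
  simp only [sub_eq_add_neg] at *
  nlinarith

lemma bellman_le {Q u v : ℝ} (hQ : 0 < Q) (hu : 0 < u) : bellman Q u v ≤ Q * v := by
  have := quarticRoot_nonneg Q u v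
  have : 0 ≤ 1 / (u * (1 + quarticRoot Q u v)) := by positivity
  unfold bellman
  gcongr
  linarith

lemma bellman_nonneg {Q u v : ℝ} (hQ : 0 < Q) (hu : 0 < u) (h : 1 ≤ u * v) :
    0 ≤ bellman Q u v := by
  have hM := quarticRoot_nonneg Q u v
  have : 1 / (u * (1 + quarticRoot Q u v)) ≤ v := by
    rw [div_le_iff₀ (by positivity)]
    nlinarith
  unfold bellman
  exact mul_nonneg hQ.le (by linarith)

lemma bellman_step_scaled {Q u v a b : ℝ} (hQ : 0 < Q) (hu : 0 < u) (hv : 0 < v)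
    (ha : |a| < 1) (hb : |b| < 1) (h : u * v ≤ Q) :
    v * (a ^ 2 + b ^ 2) ≤ 64 * (bellman Q u v -
      (bellman Q (u * (1 + a)) (v * (1 + b)) + bellman Q (u * (1 - a)) (v * (1 - b))) / 2) := by
  have hconc := quarticRoot_strict_concave hQ hu hv ha.le hb.le
  have hlow := mul_le_mul_quarticRoot hQ hu hv h
  have hM := quarticRoot_nonneg Q u v
  have hM1 := quarticRoot_le_one hQ h
  have hM₁ := quarticRoot_nonneg Q (u * (1 + a)) (v * (1 + b))
  have hM₂ := quarticRoot_nonneg Q (u * (1 - a)) (v * (1 - b))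
  unfold bellman
  set M := quarticRoot Q u v
  set M₁ := quarticRoot Q (u * (1 + a)) (v * (1 + b))
  set M₂ := quarticRoot Q (u * (1 - a)) (v * (1 - b))
  rw [abs_lt] at ha hb
  have hconv := one_div_mul_midpoint_le (a₁ := u * (1 + a)) (a₂ := u * (1 - a)) (b₁ := 1 + M₁)
    (b₂ := 1 + M₂) (mul_pos hu (by linarith)) (mul_pos hu (by linarith)) (by linarith)
    (by linarith)
  have e₁ : (u * (1 + a) + u * (1 - a)) / 2 = u := by ring
  rw [e₁] at hconv
  set N := (1 + M₁ + (1 + M₂)) / 2 with hN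
  have hN1 : 1 ≤ N := by linarith
  set s := a ^ 2 + b ^ 2
  have hs : 0 ≤ s := by positivity
  have hMN : N ≤ 1 + M - M * s / 16 := by linarith
  have hm : 0 ≤ M * s := mul_nonneg hM hs
  have key : v * s / 64 ≤ Q * (1 / (u * N) - 1 / (u * (1 + M))) := by
    have e : 1 / (u * N) - 1 / (u * (1 + M)) = (1 + M - N) / (u * (N * (1 + M))) := by
      field_simp
    rw [e, ← mul_div_assoc, le_div_iff₀ (by positivity)]
    have hprod : N * (1 + M) ≤ 4 := by nlinarith
    calc v * s / 64 * (u * (N * (1 + M))) = u * v * s / 64 * (N * (1 + M)) := by ring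
      _ ≤ u * v * s / 64 * 4 := by gcongr
      _ ≤ Q * M * s / 64 * 4 := by gcongr
      _ = Q * (M * s / 16) := by ring
      _ ≤ Q * (1 + M - N) := by gcongr; linarith
  have := mul_le_mul_of_nonneg_left hconv hQ.le
  nlinarith

/-- The normalized square oscillation `v (a² + b²)`, where `a` and `b` are the relative differences
of the two halves and `v` is the mean of `v₁` and `v₂`. -/
def relOscillation (u₁ u₂ v₁ v₂ : ℝ) : ℝ :=
  (v₁ + v₂) / 2 * (((u₁ - u₂) / (u₁ + u₂)) ^ 2 + ((v₁ - v₂) / (v₁ + v₂)) ^ 2)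

lemma oscillation_nonneg {u₁ u₂ v₁ v₂ : ℝ} (hv₁ : 0 < v₁) (hv₂ : 0 < v₂) :
    0 ≤ relOscillation u₁ u₂ v₁ v₂ := by
  unfold relOscillation
  positivity

lemma abs_sub_div_add_lt_one {x y : ℝ} (hx : 0 < x) (hy : 0 < y) : |(x - y) / (x + y)| < 1 := by
  rw [abs_lt, lt_div_iff₀ (by positivity), div_lt_iff₀ (by positivity)]
  constructor <;> linarith

lemma half_add_mul_one_add {x y : ℝ} (h : x + y ≠ 0) :
    (x + y) / 2 * (1 + (x - y) / (x + y)) = x := by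
  field_simp
  ring

lemma half_add_mul_one_sub {x y : ℝ} (h : x + y ≠ 0) :
    (x + y) / 2 * (1 - (x - y) / (x + y)) = y := by
  field_simp
  ring

lemma oscillation_le_bellman {Q u₁ u₂ v₁ v₂ : ℝ} (hQ : 0 < Q) (hu₁ : 0 < u₁) (hu₂ : 0 < u₂)
    (hv₁ : 0 < v₁) (hv₂ : 0 < v₂) (h : (u₁ + u₂) / 2 * ((v₁ + v₂) / 2) ≤ Q) :
    relOscillation u₁ u₂ v₁ v₂ ≤ 64 * (bellman Q ((u₁ + u₂) / 2) ((v₁ + v₂) / 2) -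
      (bellman Q u₁ v₁ + bellman Q u₂ v₂) / 2) := by
  have := bellman_step_scaled hQ (by positivity) (by positivity) (abs_sub_div_add_lt_one hu₁ hu₂)
    (abs_sub_div_add_lt_one hv₁ hv₂) h
  rwa [half_add_mul_one_add (by positivity), half_add_mul_one_sub (by positivity),
    half_add_mul_one_add (by positivity), half_add_mul_one_sub (by positivity)] at this

/-- Here `x` is the relative difference of `v` on an interval, and `y` that of `u` on its
left half. -/
lemma two_mul_abs_mul_abs_le {x y : ℝ} (hx : -1 ≤ x) (hy : |y| ≤ 1) :
    2 * (|x| * |y|) ≤ 4 * x ^ 2 + 2 * ((1 + x) * y ^ 2) := by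
  rcases le_total (-1 / 2) x with h | h
  · nlinarith [sq_nonneg (|x| - |y|), sq_abs x, sq_abs y, sq_nonneg x, sq_nonneg y]
  · have h' : 1 / 2 ≤ |x| := by rw [abs_of_neg (by linarith)]; linarith
    nlinarith [sq_abs x, abs_nonneg x, abs_nonneg y, sq_nonneg y,
      mul_nonneg (show 0 ≤ 1 + x by linarith) (sq_nonneg y)]

lemma cross_term_le {u₁₁ u₁₂ u₂ v₁₁ v₁₂ v₁ v₂ u₁ : ℝ} (h₁₁ : 0 < u₁₁) (h₁₂ : 0 < u₁₂)
    (hu₂ : 0 < u₂) (hv₁₁ : 0 < v₁₁) (hv₁₂ : 0 < v₁₂) (hv₂ : 0 < v₂) (hu₁ : u₁ = (u₁₁ + u₁₂) / 2)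
    (hv₁ : v₁ = (v₁₁ + v₁₂) / 2) :
    |(v₁ - v₂) / 2| * |(u₁₁ - u₁₂) / 2| / ((u₁ + u₂) / 2) ≤
      4 * relOscillation u₁ u₂ v₁ v₂ + 2 * relOscillation u₁₁ u₁₂ v₁₁ v₁₂ := by
  have p₁ : 0 < u₁ := by rw [hu₁]; positivity
  have q₁ : 0 < v₁ := by rw [hv₁]; positivity
  have hx := abs_sub_div_add_lt_one q₁ hv₂
  have hy := abs_sub_div_add_lt_one h₁₁ h₁₂
  have ex : (v₁ + v₂) / 2 * ((v₁ - v₂) / (v₁ + v₂)) = (v₁ - v₂) / 2 := by field_simp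
  have ey : u₁ * ((u₁₁ - u₁₂) / (u₁₁ + u₁₂)) = (u₁₁ - u₁₂) / 2 := by rw [hu₁]; field_simp
  have ev := half_add_mul_one_add (x := v₁) (y := v₂) (by positivity)
  unfold relOscillation
  rw [← ex, ← ey, ← hv₁]
  set x := (v₁ - v₂) / (v₁ + v₂)
  set y := (u₁₁ - u₁₂) / (u₁₁ + u₁₂)
  set v := (v₁ + v₂) / 2
  have pv : 0 < v := by positivity
  have hxy := two_mul_abs_mul_abs_le (abs_lt.1 hx).1.le hy.le
  rw [abs_mul, abs_mul, abs_of_pos pv, abs_of_pos p₁, div_le_iff₀ (by positivity)]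
  have hle : v * |x| * (u₁ * |y|) ≤ v * (2 * (|x| * |y|)) * ((u₁ + u₂) / 2) := by
    have : 0 ≤ v * |x| * |y| := by positivity
    nlinarith
  refine hle.trans ?_
  gcongr
  have h0 : 0 ≤ v * ((u₁ - u₂) / (u₁ + u₂)) ^ 2 := by positivity
  have h1 : 0 ≤ v₁ * ((v₁₁ - v₁₂) / (v₁₁ + v₁₂)) ^ 2 := by positivity
  have := mul_le_mul_of_nonneg_left hxy pv.le
  have e : v * (2 * ((1 + x) * y ^ 2)) = 2 * (v₁ * y ^ 2) := by rw [← ev]; ring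
  nlinarith

lemma len_pos (p : ℤ × ℤ) : 0 < len p := zpow_pos two_pos _

lemma len_lhalf (p : ℤ × ℤ) : len (lhalf p) = len p / 2 := by
  rw [len, lhalf, len, zpow_sub_one₀ two_ne_zero]; ring

lemma len_rhalf (p : ℤ × ℤ) : len (rhalf p) = len p / 2 := by
  rw [len, rhalf, len, zpow_sub_one₀ two_ne_zero]; ring

lemma dyad_eq (p : ℤ × ℤ) : dyad p = Set.Ico (len p * p.2) (len p * (p.2 + 1)) := rfl

lemma dyad_lhalf (p : ℤ × ℤ) :
    dyad (lhalf p) = Set.Ico (len p * p.2) (len p * (p.2 + 1 / 2)) := by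
  rw [dyad_eq, len_lhalf, lhalf]
  push_cast
  congr 1 <;> ring

lemma dyad_rhalf (p : ℤ × ℤ) :
    dyad (rhalf p) = Set.Ico (len p * (p.2 + 1 / 2)) (len p * (p.2 + 1)) := by
  rw [dyad_eq, len_rhalf, rhalf]
  push_cast
  congr 1 <;> ring

lemma measurableSet_dyad (p : ℤ × ℤ) : MeasurableSet (dyad p) := measurableSet_Ico

lemma dyad_union (p : ℤ × ℤ) : dyad (lhalf p) ∪ dyad (rhalf p) = dyad p := by
  have := len_pos p
  rw [dyad_lhalf, dyad_rhalf, dyad_eq, Set.Ico_union_Ico_eq_Ico] <;> gcongr <;> norm_num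

lemma dyad_disjoint (p : ℤ × ℤ) : Disjoint (dyad (lhalf p)) (dyad (rhalf p)) := by
  rw [dyad_lhalf, dyad_rhalf]
  exact Set.Ico_disjoint_Ico_same

lemma integrableOn_dyad {f : ℝ → ℝ} (hf : LocallyIntegrable f volume) (p : ℤ × ℤ) :
    IntegrableOn f (dyad p) :=
  (hf.integrableOn_isCompact isCompact_Icc).mono_set Set.Ico_subset_Icc_self

lemma volume_real_dyad (p : ℤ × ℤ) : volume.real (dyad p) = len p := by
  rw [dyad_eq, Real.volume_real_Ico_of_le]
  · ring
  · have := len_pos p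
    gcongr
    linarith

lemma len_mul_avg (f : ℝ → ℝ) (p : ℤ × ℤ) : len p * avg f p = ∫ x in dyad p, f x := by
  rw [avg, mul_inv_cancel_left₀ (len_pos p).ne']

lemma avg_eq_half_add {f : ℝ → ℝ} (hf : LocallyIntegrable f volume) (p : ℤ × ℤ) :
    avg f p = (avg f (lhalf p) + avg f (rhalf p)) / 2 := by
  have := len_pos p
  rw [avg, avg, avg, ← dyad_union p, setIntegral_union (dyad_disjoint p) (measurableSet_dyad _)
    (integrableOn_dyad hf _) (integrableOn_dyad hf _), len_lhalf, len_rhalf]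
  field_simp

lemma haarCoeff_eq {f : ℝ → ℝ} (hf : LocallyIntegrable f volume) (p : ℤ × ℤ) :
    haarCoeff f p = √(len p) * ((avg f (lhalf p) - avg f (rhalf p)) / 2) := by
  have hL := len_pos p
  have hcongr : ∀ x, f x * haar p x = (√(len p))⁻¹ *
      ((dyad (lhalf p)).indicator f x - (dyad (rhalf p)).indicator f x) := fun x => by
    by_cases h₁ : x ∈ dyad (lhalf p) <;> by_cases h₂ : x ∈ dyad (rhalf p) <;>
      simp [haar, h₁, h₂, mul_comm]
  have hs : √(len p) * √(len p) = len p := Real.mul_self_sqrt hL.le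
  have hs0 : √(len p) ≠ 0 := (Real.sqrt_pos.2 hL).ne'
  rw [haarCoeff, integral_congr_ae (Filter.Eventually.of_forall hcongr), integral_const_mul,
    integral_sub ((integrable_indicator_iff (measurableSet_dyad _)).2 (integrableOn_dyad hf _))
      ((integrable_indicator_iff (measurableSet_dyad _)).2 (integrableOn_dyad hf _)),
    integral_indicator (measurableSet_dyad _), integral_indicator (measurableSet_dyad _),
    ← len_mul_avg, ← len_mul_avg, len_lhalf, len_rhalf, inv_mul_eq_iff_eq_mul₀ hs0, ← mul_assoc, hs]
  ring

lemma avg_pos {f : ℝ → ℝ} (hf : LocallyIntegrable f volume) (hpos : ∀ x, 0 < f x) (p : ℤ × ℤ) :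
    0 < avg f p := by
  refine mul_pos (inv_pos.2 (len_pos p)) ?_
  rw [setIntegral_pos_iff_support_of_nonneg_ae (Filter.Eventually.of_forall fun x => (hpos x).le)
    (integrableOn_dyad hf p), Function.support_eq_univ fun x => (hpos x).ne', Set.univ_inter,
    dyad_eq, Real.volume_Ico, ENNReal.ofReal_pos]
  linarith [len_pos p]

lemma one_le_avg_mul_avg_inv {ω : ℝ → ℝ} (hω : IsWeight ω) (p : ℤ × ℤ) :
    1 ≤ avg ω p * avg (fun x => (ω x)⁻¹) p := by
  obtain ⟨-, hpos, hw, hs⟩ := hω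
  have hu := avg_pos hw hpos p
  have hL := len_pos p
  have hc : Integrable (fun _ : ℝ => 2 / avg ω p) (volume.restrict (dyad p)) :=
    integrableOn_const (by simp [dyad])
  have hint : ∫ x in dyad p, (2 / avg ω p - (1 / avg ω p ^ 2) * ω x) ≤ ∫ x in dyad p, (ω x)⁻¹ := by
    refine setIntegral_mono (hc.sub ((integrableOn_dyad hw p).const_mul _))
      (integrableOn_dyad hs p) fun x => ?_
    have := hpos x
    rw [← sub_nonneg]
    have e : (ω x)⁻¹ - (2 / avg ω p - 1 / avg ω p ^ 2 * ω x)
        = (avg ω p - ω x) ^ 2 / (ω x * avg ω p ^ 2) := by field_simp; ring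
    rw [e]
    positivity
  rw [integral_sub hc ((integrableOn_dyad hw p).const_mul _),
    integral_const_mul, setIntegral_const, volume_real_dyad, ← len_mul_avg, ← len_mul_avg,
    smul_eq_mul] at hint
  have e : len p * (2 / avg ω p) - 1 / avg ω p ^ 2 * (len p * avg ω p) = len p * (1 / avg ω p) := by
    field_simp; ring
  rw [e, mul_le_mul_iff_right₀ hL, div_le_iff₀ hu] at hint
  linarith

/-- The dyadic descendants of `p` of generation less than `n`, including `p` itself. -/
def descendants : ℕ → ℤ × ℤ → Finset (ℤ × ℤ)
  | 0, _ => ∅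
  | n + 1, p => insert p (descendants n (lhalf p) ∪ descendants n (rhalf p))

lemma mem_descendants {n k : ℕ} {p q : ℤ × ℤ} (hkn : k < n) (hk : p.1 + k = q.1)
    (h₁ : q.2 * 2 ^ k ≤ p.2) (h₂ : p.2 + 1 ≤ (q.2 + 1) * 2 ^ k) : p ∈ descendants n q := by
  induction n generalizing k q with
  | zero => omega
  | succ n ih =>
    rw [descendants, Finset.mem_insert, Finset.mem_union]
    cases k with
    | zero =>
      left
      simp only [pow_zero, mul_one, Nat.cast_zero] at h₁ h₂ hk
      exact Prod.ext (by omega) (by omega)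
    | succ k =>
      right
      push_cast at hk
      rw [pow_succ] at h₁ h₂
      rcases lt_or_ge p.2 ((2 * q.2 + 1) * 2 ^ k) with h | h
      · left
        exact ih (k := k) (by omega) (by simp only [lhalf]; omega)
          (by simp only [lhalf]; linarith) (by simp only [lhalf]; omega)
      · right
        exact ih (k := k) (by omega) (by simp only [rhalf]; omega)
          (by simp only [rhalf]; linarith) (by simp only [rhalf]; linarith)

lemma exists_mem_descendants {p q : ℤ × ℤ} (h : dyad p ⊆ dyad q) :
    ∃ k : ℕ, ∀ n, k < n → p ∈ descendants n q := by
  have hp := len_pos p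
  have hq := len_pos q
  rw [dyad_eq, dyad_eq, Set.Ico_subset_Ico_iff (by gcongr; linarith)] at h
  obtain ⟨h₁, h₂⟩ := h
  have hlen : len p ≤ len q := by linarith
  have hle : p.1 ≤ q.1 := (zpow_le_zpow_iff_right₀ (one_lt_two : (1:ℝ) < 2)).1 hlen
  obtain ⟨k, hk⟩ := Int.le.dest hle
  have hlq : len q = len p * 2 ^ k := by
    rw [len, len, ← hk, zpow_add₀ two_ne_zero, zpow_natCast]
  rw [hlq, mul_assoc, mul_le_mul_iff_right₀ hp] at h₁ h₂
  refine ⟨k, fun n hn => mem_descendants hn hk ?_ ?_⟩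
  · rw [mul_comm]; exact_mod_cast h₁
  · rw [mul_comm (q.2 + 1)]; exact_mod_cast h₂

lemma sum_descendants_le {T D P : ℤ × ℤ → ℝ} (hT : ∀ p, 0 ≤ T p) (hP : ∀ p, 0 ≤ P p)
    (hD : ∀ p, 0 ≤ D p)
    (hTD : ∀ p, T p ≤ 4 * D p + 4 * D (lhalf p))
    (hDP : ∀ p, D p ≤ 64 * (P p - P (lhalf p) - P (rhalf p))) (n : ℕ) (p : ℤ × ℤ) :
    ∑ x ∈ descendants n p, T x ≤ 512 * P p - 4 * D p := by
  induction n generalizing p with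
  | zero =>
    rw [descendants, Finset.sum_empty]
    linarith [hDP p, hP p, hP (lhalf p), hP (rhalf p), hD p]
  | succ n ih =>
    have hunion := Finset.sum_union_inter (s₁ := descendants n (lhalf p))
      (s₂ := descendants n (rhalf p)) (f := T)
    have hinter : 0 ≤ ∑ x ∈ descendants n (lhalf p) ∩ descendants n (rhalf p), T x :=
      Finset.sum_nonneg fun x _ => hT x
    have hins : ∑ x ∈ descendants (n + 1) p, T x ≤
        T p + ∑ x ∈ descendants n (lhalf p) ∪ descendants n (rhalf p), T x := by
      rw [descendants]
      by_cases hmem : p ∈ descendants n (lhalf p) ∪ descendants n (rhalf p)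
      · rw [Finset.insert_eq_of_mem hmem]
        linarith [hT p]
      · rw [Finset.sum_insert hmem]
    linarith [ih (lhalf p), ih (rhalf p), hTD p, hDP p, hD (rhalf p)]

lemma tsum_dyad_subset_le {T : ℤ × ℤ → ℝ} (hT : ∀ p, 0 ≤ T p) {q : ℤ × ℤ} {B : ℝ}
    (h : ∀ n, ∑ x ∈ descendants n q, T x ≤ B) :
    ∑' p : {p : ℤ × ℤ // dyad p ⊆ dyad q}, ENNReal.ofReal (T p.1) ≤ ENNReal.ofReal B := by
  rw [ENNReal.tsum_eq_iSup_sum]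
  refine iSup_le fun s => ?_
  choose k hk using fun p : {p : ℤ × ℤ // dyad p ⊆ dyad q} => exists_mem_descendants p.2
  rw [← ENNReal.ofReal_sum_of_nonneg fun p _ => hT p.1]
  refine ENNReal.ofReal_le_ofReal (le_trans ?_ (h (s.sup k + 1)))
  refine (Finset.sum_map s (Function.Embedding.subtype _) T).ge.trans ?_
  refine Finset.sum_le_sum_of_subset_of_nonneg (fun x hx => ?_) fun x _ _ => hT x
  obtain ⟨y, hy, rfl⟩ := Finset.mem_map.1 hx
  exact hk y _ (Nat.lt_succ_of_le (Finset.le_sup hy))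

/-- `∑_{I ⊆ J} |⟨ω⁻¹, h_I⟩ ⟨ω, h_{I₋}⟩| / ⟨ω⟩_I ≤ C [ω]_{A₂} ω⁻¹(J)`. -/
theorem statement6 :
    ∃ C : ℝ≥0, ∀ ω : ℝ → ℝ, IsWeight ω → A2 ω < ⊤ → ∀ q : ℤ × ℤ,
      ∑' p : {p : ℤ × ℤ // dyad p ⊆ dyad q},
          ENNReal.ofReal
            (|haarCoeff (fun x => (ω x)⁻¹) p.1 * haarCoeff ω (lhalf p.1)| / avg ω p.1) ≤
        (C : ℝ≥0∞) * A2 ω * ENNReal.ofReal (∫ x in dyad q, (ω x)⁻¹) := by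
  refine ⟨512, fun ω hω hA q => ?_⟩
  obtain ⟨-, hpos, hw, hs⟩ := id hω
  set σ : ℝ → ℝ := fun x => (ω x)⁻¹
  have hu := avg_pos hw hpos
  have hv : ∀ p, 0 < avg σ p := avg_pos hs fun x => inv_pos.2 (hpos x)
  set Q := (A2 ω).toReal with hQdef
  have huv : ∀ p, avg ω p * avg σ p ≤ Q := fun p => by
    rw [← ENNReal.ofReal_le_iff_le_toReal hA.ne]
    exact le_iSup (fun p => ENNReal.ofReal (avg ω p * avg σ p)) p
  have hQ : 0 < Q := (mul_pos (hu q) (hv q)).trans_le (huv q)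
  set D : ℤ × ℤ → ℝ := fun p => len p *
    relOscillation (avg ω (lhalf p)) (avg ω (rhalf p)) (avg σ (lhalf p)) (avg σ (rhalf p)) with hD
  set P : ℤ × ℤ → ℝ := fun p => len p * bellman Q (avg ω p) (avg σ p) with hP
  set T : ℤ × ℤ → ℝ := fun p => |haarCoeff σ p * haarCoeff ω (lhalf p)| / avg ω p with hT
  have hT0 : ∀ p, 0 ≤ T p := fun p => div_nonneg (abs_nonneg _) (hu p).le
  have hDP : ∀ p, D p ≤ 64 * (P p - P (lhalf p) - P (rhalf p)) := fun p => by
    have h := oscillation_le_bellman hQ (hu (lhalf p)) (hu (rhalf p)) (hv (lhalf p)) (hv (rhalf p))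
      (by rw [← avg_eq_half_add hw, ← avg_eq_half_add hs]; exact huv p)
    rw [← avg_eq_half_add hw, ← avg_eq_half_add hs] at h
    have := mul_le_mul_of_nonneg_left h (len_pos p).le
    simp only [hD, hP, len_lhalf, len_rhalf]
    linarith
  have hTD : ∀ p, T p ≤ 4 * D p + 4 * D (lhalf p) := fun p => by
    have hL := len_pos p
    have h := cross_term_le (hu (lhalf (lhalf p))) (hu (rhalf (lhalf p))) (hu (rhalf p))
      (hv (lhalf (lhalf p))) (hv (rhalf (lhalf p))) (hv (rhalf p))
      (avg_eq_half_add hw (lhalf p)) (avg_eq_half_add hs (lhalf p))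
    rw [← avg_eq_half_add hw p] at h
    have hsqrt : √(len p) * √(len (lhalf p)) ≤ len p := by
      rw [← Real.sqrt_mul hL.le, len_lhalf]
      exact Real.sqrt_le_iff.2 ⟨hL.le, by nlinarith⟩
    have hmul := mul_le_mul_of_nonneg_left h hL.le
    have hle : T p ≤ len p * (|(avg σ (lhalf p) - avg σ (rhalf p)) / 2| *
        |(avg ω (lhalf (lhalf p)) - avg ω (rhalf (lhalf p))) / 2| / avg ω p) := by
      simp only [hT]
      rw [haarCoeff_eq hs, haarCoeff_eq hw, abs_mul, abs_mul, abs_mul, abs_of_nonneg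
        (Real.sqrt_nonneg _), abs_of_nonneg (Real.sqrt_nonneg _), mul_mul_mul_comm, mul_div_assoc]
      exact mul_le_mul_of_nonneg_right hsqrt (div_nonneg (by positivity) (hu p).le)
    simp only [hD, len_lhalf]
    linarith
  have hD0 : ∀ p, 0 ≤ D p := fun p =>
    mul_nonneg (len_pos p).le (oscillation_nonneg (hv (lhalf p)) (hv (rhalf p)))
  have hP0 : ∀ p, 0 ≤ P p := fun p =>
    mul_nonneg (len_pos p).le (bellman_nonneg hQ (hu p) (one_le_avg_mul_avg_inv hω p))
  refine (tsum_dyad_subset_le hT0 fun n => sum_descendants_le hT0 hP0 hD0 hTD hDP n q).trans ?_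
  have hfin : 512 * P q - 4 * D q ≤ 512 * Q * ∫ x in dyad q, σ x := by
    have := mul_le_mul_of_nonneg_left (bellman_le (v := avg σ q) hQ (hu q)) (len_pos q).le
    rw [← len_mul_avg]
    linarith [hD0 q]
  refine (ENNReal.ofReal_le_ofReal hfin).trans_eq ?_
  rw [ENNReal.ofReal_mul (by positivity), ENNReal.ofReal_mul (by norm_num), hQdef,
    ENNReal.ofReal_toReal hA.ne]
  norm_num
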